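/- Let f be a proper log-concave function on ℝ^d and 0 < s_1 < s_2. Let E_{s_1}(f) and E_{s_2}(f) denote the John s_1-ellipsoid and John s_2-ellipsoid of f. Then √((s_2/(d+s_2))^{s_2} · (d/(d+s_2))^d) · κ_{s_1}/κ_{s_2} ≤ μ_{s_1}(E_{s_1}(f)) / μ_{s_2}(E_{s_2}(f)) ≤ κ_{s_1}/κ_{s_2}, where κ_s = ∫_{B^d}(1−|x|²)^{s/2} dx. -/

import Mathlib

open MeasureTheory
open scoped BigOperators RealInnerProductSpace

noncomputable section

/-- `ℝ^d` with the Euclidean structure. -/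
abbrev Ed (d : ℕ) := EuclideanSpace ℝ (Fin d)

/-- `f : ℝ^d → [0,∞)` is log-concave, i.e. `f = e^{-ψ}` for some convex
`ψ : ℝ^d → ℝ ∪ {∞}`; equivalently, `f ≥ 0` and
`f(tx+(1-t)y) ≥ f(x)^t f(y)^{1-t}`. -/
def IsLogConcave {d : ℕ} (f : Ed d → ℝ) : Prop :=
  (∀ x, 0 ≤ f x) ∧
    ∀ x y : Ed d, ∀ t : ℝ, 0 ≤ t → t ≤ 1 →
      f x ^ t * f y ^ (1 - t) ≤ f (t • x + (1 - t) • y)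

/-- A proper log-concave function: log-concave, upper semicontinuous,
with positive finite integral. -/
def ProperLogConcave {d : ℕ} (f : Ed d → ℝ) : Prop :=
  IsLogConcave f ∧ UpperSemicontinuous f ∧
    0 < ∫⁻ x, ENNReal.ofReal (f x) ∧ (∫⁻ x, ENNReal.ofReal (f x)) < ⊤

/-- The `s`-lifting of `f`, a subset of `ℝ^d × ℝ = ℝ^{d+1}`. -/
def sLift {d : ℕ} (s : ℝ) (f : Ed d → ℝ) : Set (Ed d × ℝ) :=
  {p | |p.2| ≤ f p.1 ^ (1 / s)}

/-- The `d`-symmetric ellipsoid `(A⊕α)B^{d+1} + a` in `ℝ^{d+1} = ℝ^d × ℝ`. -/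
def ellE {d : ℕ} (A : Matrix (Fin d) (Fin d) ℝ) (α : ℝ) (a : Ed d) : Set (Ed d × ℝ) :=
  {p | ∃ y : Ed d, ∃ t : ℝ, ‖y‖ ^ 2 + t ^ 2 ≤ 1 ∧
        p.1 = Matrix.toEuclideanLin A y + a ∧ p.2 = α * t}

/-- The closed Euclidean unit ball `B^{d+1}` of `ℝ^{d+1} = ℝ^d × ℝ`. -/
def unitBallE (d : ℕ) : Set (Ed d × ℝ) := {p | ‖p.1‖ ^ 2 + p.2 ^ 2 ≤ 1}

/-- `κ_s = ∫_{B^d} (1-|x|²)^{s/2} dx`. -/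
def kappa (d : ℕ) (s : ℝ) : ℝ :=
  ∫ x in Metric.closedBall (0 : Ed d) 1, (1 - ‖x‖ ^ 2) ^ (s / 2)

/-- The `s`-volume of the ellipsoid represented by `(A⊕α, a)`:
`μ_s = κ_s α^s det A`. -/
def svol {d : ℕ} (s : ℝ) (A : Matrix (Fin d) (Fin d) ℝ) (α : ℝ) : ℝ :=
  kappa d s * α ^ s * A.det

/-- `(A, α, a)` represents the John `s`-ellipsoid of `f`: it is a d-symmetric
ellipsoid contained in the `s`-lifting of `f` of maximal `s`-volume. -/
def IsJohn {d : ℕ} (s : ℝ) (f : Ed d → ℝ)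
    (A : Matrix (Fin d) (Fin d) ℝ) (α : ℝ) (a : Ed d) : Prop :=
  A.PosDef ∧ 0 < α ∧ ellE A α a ⊆ sLift s f ∧
    ∀ (A' : Matrix (Fin d) (Fin d) ℝ) (α' : ℝ) (a' : Ed d),
      A'.PosDef → 0 < α' → ellE A' α' a' ⊆ sLift s f → svol s A' α' ≤ svol s A α

/-- The height function of the ellipsoid represented by `(A⊕α, a)`. -/
def heightFn {d : ℕ} (A : Matrix (Fin d) (Fin d) ℝ) (α : ℝ) (a : Ed d) (x : Ed d) : ℝ :=
  if ‖Matrix.toEuclideanLin A⁻¹ (x - a)‖ ≤ 1 then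
    α * Real.sqrt (1 - ‖Matrix.toEuclideanLin A⁻¹ (x - a)‖ ^ 2)
  else 0

/-- A point of `ℝ^d × ℝ` as a vector in `ℝ^{d+1}`. -/
def augVec {d : ℕ} (p : Ed d × ℝ) : Fin (d + 1) → ℝ :=
  Fin.snoc (fun i => p.1 i) p.2

/-- The block-diagonal matrix `A ⊕ α`. -/
def matAug {d : ℕ} (A : Matrix (Fin d) (Fin d) ℝ) (α : ℝ) :
    Matrix (Fin (d + 1)) (Fin (d + 1)) ℝ :=
  Matrix.of fun i j =>
    Fin.lastCases (Fin.lastCases α (fun _ => 0) j)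
      (fun i' => Fin.lastCases 0 (fun j' => A i' j') j) i

/-- The Frobenius norm of a real matrix. -/
def frobNorm {n : ℕ} (M : Matrix (Fin n) (Fin n) ℝ) : ℝ :=
  Real.sqrt (∑ i, ∑ j, M i j ^ 2)

/-- Asplund sum (sup-convolution) of two functions. -/
def asplund {d : ℕ} (f g : Ed d → ℝ) : Ed d → ℝ :=
  fun x => ⨆ y : Ed d, f y * g (x - y)

/-- Epi-product `(λ ∗ f)(x) = f(x/λ)^λ`. -/
def epiProd {d : ℕ} (l : ℝ) (f : Ed d → ℝ) : Ed d → ℝ :=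
  fun x => f (l⁻¹ • x) ^ l

/-- The flat ellipsoid function `α · χ_{A B^d + a}`. -/
def flatFn {d : ℕ} (A : Matrix (Fin d) (Fin d) ℝ) (α : ℝ) (a : Ed d) (x : Ed d) : ℝ :=
  if ‖Matrix.toEuclideanLin A⁻¹ (x - a)‖ ≤ 1 then α else 0

/-- The Gaussian density `G[(A⊕α, a)](x) = α e^{−|A^{-1}(x−a)|²}`. -/
def gaussFn {d : ℕ} (A : Matrix (Fin d) (Fin d) ℝ) (α : ℝ) (a : Ed d) (x : Ed d) : ℝ :=
  α * Real.exp (-‖Matrix.toEuclideanLin A⁻¹ (x - a)‖ ^ 2)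

/-- Operator (`ℓ₂ → ℓ₂`) norm of a matrix. -/
def opNorm {d : ℕ} (M : Matrix (Fin d) (Fin d) ℝ) : ℝ :=
  ‖Matrix.toEuclideanCLM (𝕜 := ℝ) M‖

/-- `κ_s` is positive for `s ≥ 0`. -/
theorem kappa_pos (d : ℕ) {s : ℝ} (hs : 0 ≤ s) : 0 < kappa d s := by
  have hcont : Continuous fun x : Ed d => (1 - ‖x‖ ^ 2) ^ (s / 2) :=
    (by fun_prop : Continuous fun x : Ed d => 1 - ‖x‖ ^ 2).rpow_const
      fun _ => Or.inr (by positivity)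
  have hnonneg : ∀ x ∈ Metric.closedBall (0 : Ed d) 1, 0 ≤ (1 - ‖x‖ ^ 2) ^ (s / 2) := by
    intro x hx
    rw [mem_closedBall_zero_iff] at hx
    exact Real.rpow_nonneg (by nlinarith [norm_nonneg x]) _
  unfold kappa
  rw [setIntegral_pos_iff_support_of_nonneg_ae
    (ae_restrict_of_forall_mem Metric.isClosed_closedBall.measurableSet hnonneg)
    (hcont.continuousOn.integrableOn_compact (isCompact_closedBall _ _))]
  refine (Metric.measure_ball_pos volume (0 : Ed d) one_pos).trans_le (measure_mono ?_)
  intro x hx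
  refine ⟨?_, Metric.ball_subset_closedBall hx⟩
  rw [mem_ball_zero_iff] at hx
  exact (Real.rpow_pos_of_pos (by nlinarith [norm_nonneg x]) _).ne'

/-- A `d`-symmetric ellipsoid lies in the `s`-lifting of `f` iff the `s`-th power of its height
function is dominated by `f` on the base of the ellipsoid. -/
theorem ellE_subset_sLift_iff {d : ℕ} {s : ℝ} (hs : 0 < s) {f : Ed d → ℝ} (hf : ∀ x, 0 ≤ f x)
    {A : Matrix (Fin d) (Fin d) ℝ} {α : ℝ} (hα : 0 < α) {a : Ed d} :
    ellE A α a ⊆ sLift s f ↔ ∀ y : Ed d, ‖y‖ ≤ 1 →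
      α ^ s * (1 - ‖y‖ ^ 2) ^ (s / 2) ≤ f (Matrix.toEuclideanLin A y + a) := by
  have hpow : ∀ y : Ed d, ‖y‖ ≤ 1 →
      α ^ s * (1 - ‖y‖ ^ 2) ^ (s / 2) = (α * √(1 - ‖y‖ ^ 2)) ^ s := by
    intro y hy
    have h0 : 0 ≤ 1 - ‖y‖ ^ 2 := by nlinarith [norm_nonneg y]
    rw [Real.mul_rpow hα.le (Real.sqrt_nonneg _), Real.sqrt_eq_rpow, ← Real.rpow_mul h0,
      one_div_mul_eq_div]
  constructor
  · intro h y hy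
    have h0 : 0 ≤ 1 - ‖y‖ ^ 2 := by nlinarith [norm_nonneg y]
    have hmem : (Matrix.toEuclideanLin A y + a, α * √(1 - ‖y‖ ^ 2)) ∈ ellE A α a :=
      ⟨y, √(1 - ‖y‖ ^ 2), by rw [Real.sq_sqrt h0]; linarith, rfl, rfl⟩
    have hle : |α * √(1 - ‖y‖ ^ 2)| ≤ f (Matrix.toEuclideanLin A y + a) ^ (1 / s) := h hmem
    rw [abs_of_nonneg (by positivity), one_div,
      Real.le_rpow_inv_iff_of_pos (by positivity) (hf _) hs] at hle
    rwa [hpow y hy]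
  · rintro h ⟨x, ξ⟩ ⟨y, t, hyt, rfl : x = _, rfl : ξ = _⟩
    have hy : ‖y‖ ≤ 1 := by nlinarith [norm_nonneg y, sq_nonneg t]
    have hle := h y hy
    rw [hpow y hy, ← Real.le_rpow_inv_iff_of_pos (by positivity) (hf _) hs] at hle
    change |α * t| ≤ f (Matrix.toEuclideanLin A y + a) ^ (1 / s)
    rw [abs_mul, abs_of_pos hα, one_div]
    refine le_trans ?_ hle
    gcongr
    exact Real.abs_le_sqrt (by linarith)

/-- The John `s`-ellipsoid maximizes `α ^ s * det A`. -/
theorem IsJohn.rpow_mul_det_le {d : ℕ} {s : ℝ} (hs : 0 < s) {f : Ed d → ℝ}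
    {A A' : Matrix (Fin d) (Fin d) ℝ} {α α' : ℝ} {a a' : Ed d} (hJ : IsJohn s f A α a)
    (hA' : A'.PosDef) (hα' : 0 < α') (hsub : ellE A' α' a' ⊆ sLift s f) :
    α' ^ s * A'.det ≤ α ^ s * A.det := by
  have h := hJ.2.2.2 A' α' a' hA' hα' hsub
  unfold svol at h
  rw [mul_assoc, mul_assoc] at h
  exact le_of_mul_le_mul_left h (kappa_pos d hs.le)

/-- An ellipsoid in the `s₁`-lifting yields one in the `s₂`-lifting, for `s₁ ≤ s₂`, with the same
base and with `α ^ s` preserved. -/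
theorem ellE_subset_sLift_of_le {d : ℕ} {s₁ s₂ : ℝ} (hs₁ : 0 < s₁) (hs : s₁ ≤ s₂)
    {f : Ed d → ℝ} (hf : ∀ x, 0 ≤ f x) {A : Matrix (Fin d) (Fin d) ℝ} {α : ℝ} (hα : 0 < α)
    {a : Ed d} (h : ellE A α a ⊆ sLift s₁ f) :
    ellE A ((α ^ s₁) ^ s₂⁻¹) a ⊆ sLift s₂ f := by
  have hs₂ : 0 < s₂ := hs₁.trans_le hs
  rw [ellE_subset_sLift_iff hs₁ hf hα] at h
  rw [ellE_subset_sLift_iff hs₂ hf (by positivity)]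
  intro y hy
  refine le_trans ?_ (h y hy)
  rw [Real.rpow_inv_rpow (by positivity) hs₂.ne']
  have h0 : 0 ≤ 1 - ‖y‖ ^ 2 := by nlinarith [norm_nonneg y]
  gcongr ?_ * ?_
  exact Real.rpow_le_rpow_of_exponent_ge_of_imp h0 (by nlinarith [sq_nonneg ‖y‖])
    (by linarith) fun _ h => absurd h (by positivity)

/-- Cutting an ellipsoid in the `s₂`-lifting to the shrunken base `c A` with `c² = 1 - q` yields an
ellipsoid in the `s₁`-lifting whose `α ^ s` is multiplied by `q ^ (s₂ / 2)`. -/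
theorem ellE_smul_subset_sLift {d : ℕ} {s₁ s₂ : ℝ} (hs₁ : 0 < s₁) (hs₂ : 0 < s₂)
    {f : Ed d → ℝ} (hf : ∀ x, 0 ≤ f x) {A : Matrix (Fin d) (Fin d) ℝ} {α : ℝ} (hα : 0 < α)
    {a : Ed d} (h : ellE A α a ⊆ sLift s₂ f) {c q : ℝ} (hc : 0 ≤ c) (hq : 0 < q)
    (hcq : c ^ 2 = 1 - q) :
    ellE (c • A) ((α ^ s₂ * q ^ (s₂ / 2)) ^ s₁⁻¹) a ⊆ sLift s₁ f := by
  rw [ellE_subset_sLift_iff hs₂ hf hα] at h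
  rw [ellE_subset_sLift_iff hs₁ hf (by positivity)]
  intro y hy
  have hcy : ‖c • y‖ ^ 2 ≤ 1 - q := by
    rw [norm_smul, mul_pow, Real.norm_of_nonneg hc, hcq]
    have h1 : 0 ≤ 1 - q := hcq ▸ sq_nonneg c
    exact mul_le_of_le_one_right h1 (pow_le_one₀ (norm_nonneg y) hy)
  have hle := h (c • y) (by nlinarith [norm_nonneg (c • y)])
  have heq : Matrix.toEuclideanLin (c • A) y = Matrix.toEuclideanLin A (c • y) := by
    rw [map_smul, map_smul, LinearMap.smul_apply]
  rw [Real.rpow_inv_rpow (by positivity) hs₁.ne', heq]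
  refine le_trans ?_ hle
  have h0 : 0 ≤ 1 - ‖y‖ ^ 2 := by nlinarith [norm_nonneg y]
  refine (mul_le_of_le_one_right (by positivity)
    (Real.rpow_le_one h0 (by nlinarith [sq_nonneg ‖y‖]) (by positivity))).trans ?_
  gcongr
  linarith

/-- **Comparison of `s`-volumes of John `s`-ellipsoids for distinct `s`**
(Lemma 6.1). -/
theorem compare_john_svolumes (d : ℕ) (hd : 1 ≤ d) (s₁ s₂ : ℝ)
    (hs₁ : 0 < s₁) (hs : s₁ < s₂)
    (f : Ed d → ℝ) (hf : ProperLogConcave f)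
    (A₁ A₂ : Matrix (Fin d) (Fin d) ℝ) (α₁ α₂ : ℝ) (a₁ a₂ : Ed d)
    (hJ₁ : IsJohn s₁ f A₁ α₁ a₁) (hJ₂ : IsJohn s₂ f A₂ α₂ a₂) :
    Real.sqrt ((s₂ / ((d : ℝ) + s₂)) ^ s₂ * ((d : ℝ) / ((d : ℝ) + s₂)) ^ d) *
        (kappa d s₁ / kappa d s₂) ≤
      svol s₁ A₁ α₁ / svol s₂ A₂ α₂ ∧
    svol s₁ A₁ α₁ / svol s₂ A₂ α₂ ≤ kappa d s₁ / kappa d s₂ := by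
  have hs₂ : 0 < s₂ := hs₁.trans hs
  have hf0 := hf.1.1
  have hα₁ := hJ₁.2.1
  have hα₂ := hJ₂.2.1
  have hκ₁ := kappa_pos d hs₁.le
  have hκ₂ := kappa_pos d hs₂.le
  have hdet₂ := hJ₂.1.det_pos
  have hpos : 0 < α₂ ^ s₂ * A₂.det := by positivity
  have hratio : svol s₁ A₁ α₁ / svol s₂ A₂ α₂ =
      (α₁ ^ s₁ * A₁.det) / (α₂ ^ s₂ * A₂.det) * (kappa d s₁ / kappa d s₂) := by
    unfold svol
    field_simp
  rw [hratio]
  constructor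
  · have hd0 : (0 : ℝ) < d := by exact_mod_cast hd
    set p : ℝ := d / (d + s₂)
    set q : ℝ := s₂ / (d + s₂)
    have hp : 0 < p := by positivity
    have hq : 0 < q := by positivity
    have hpq : √p ^ 2 = 1 - q := by
      rw [Real.sq_sqrt hp.le, eq_sub_iff_add_eq, ← add_div, div_self (by positivity)]
    have hsub := ellE_smul_subset_sLift hs₁ hs₂ hf0 hα₂ hJ₂.2.2.1 (Real.sqrt_nonneg p) hq hpq
    have hle := hJ₁.rpow_mul_det_le hs₁ (hJ₂.1.smul (Real.sqrt_pos.2 hp)) (by positivity) hsub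
    rw [Real.rpow_inv_rpow (by positivity) hs₁.ne', Matrix.det_smul, Fintype.card_fin] at hle
    have hsqrt : √(q ^ s₂ * p ^ d) = q ^ (s₂ / 2) * √p ^ d := by
      rw [Real.sqrt_eq_iff_mul_self_eq (by positivity) (by positivity), mul_mul_mul_comm,
        ← Real.rpow_add hq, add_halves, ← mul_pow, Real.mul_self_sqrt hp.le]
    gcongr
    rw [le_div_iff₀ hpos, hsqrt]
    linarith
  · refine mul_le_of_le_one_left (by positivity) ((div_le_one hpos).2 ?_)
    have hsub := ellE_subset_sLift_of_le hs₁ hs.le hf0 hα₁ hJ₁.2.2.1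
    have hle := hJ₂.rpow_mul_det_le hs₂ hJ₁.1 (by positivity) hsub
    rwa [Real.rpow_inv_rpow (by positivity) hs₂.ne'] at hle
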